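/- Quantum realizability of the Steinmetz solid in the chain configuration: Consider 4 qubits labeled 1, 2, 3, 4 in a chain with bipartite links (1,2), (1,3) and (3,4). Suppose b₁₂, b₁₃, b₃₄ are nonnegative real numbers satisfying b₁₂² + b₁₃² ≤ 2 and b₁₃² + b₃₄² ≤ 2. Then there exists a 4-qubit density matrix ρ such that Σ_{k,l ∈ {x,z}} (Tr(ρ σ_k^{(1)} σ_l^{(2)}))² = b₁₂², Σ_{k,l ∈ {x,z}} (Tr(ρ σ_k^{(1)} σ_l^{(3)}))² = b₁₃², and Σ_{k,l ∈ {x,z}} (Tr(ρ σ_k^{(3)} σ_l^{(4)}))² = b₃₄². -/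

import Mathlib

open Matrix Complex ComplexOrder

noncomputable section

/-- The Pauli X matrix. -/
def pX : Matrix (Fin 2) (Fin 2) ℂ := !![0, 1; 1, 0]

/-- The Pauli Y matrix. -/
def pY : Matrix (Fin 2) (Fin 2) ℂ := !![0, -Complex.I; Complex.I, 0]

/-- The Pauli Z matrix. -/
def pZ : Matrix (Fin 2) (Fin 2) ℂ := !![1, 0; 0, -1]

/-- The operator on `n` qubits acting as the single-qubit operator `M` on qubit `i`
and as the identity on all other qubits. -/
def onQubit {n : ℕ} (M : Matrix (Fin 2) (Fin 2) ℂ) (i : Fin n) :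
    Matrix (Fin n → Fin 2) (Fin n → Fin 2) ℂ :=
  Matrix.of fun a b => ∏ s, if s = i then M (a s) (b s) else (if a s = b s then 1 else 0)

/-- An `n`-qubit density matrix: positive semidefinite with unit trace. -/
def IsDensityMatrix {n : ℕ} (ρ : Matrix (Fin n → Fin 2) (Fin n → Fin 2) ℂ) : Prop :=
  ρ.PosSemidef ∧ ρ.trace = 1

/-- The two Pauli matrices spanning the xy plane. -/
def XY : Fin 2 → Matrix (Fin 2) (Fin 2) ℂ := ![pX, pY]

/-- The two Pauli matrices spanning the xz plane. -/
def XZ : Fin 2 → Matrix (Fin 2) (Fin 2) ℂ := ![pX, pZ]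

/-- The xy-plane Bell strength 𝒯²_{ij}(ρ) of the pair of qubits (i,j). -/
def T2pair {n : ℕ} (ρ : Matrix (Fin n → Fin 2) (Fin n → Fin 2) ℂ) (i j : Fin n) : ℝ :=
  ∑ k : Fin 2, ∑ l : Fin 2,
    ((ρ * (onQubit (XY k) i * onQubit (XY l) j)).trace.re) ^ 2

/-- The xy-plane Bell strength 𝒯²_{ijm}(ρ) of the triple of qubits (i,j,m). -/
def T2triple {n : ℕ} (ρ : Matrix (Fin n → Fin 2) (Fin n → Fin 2) ℂ) (i j m : Fin n) : ℝ :=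
  ∑ k : Fin 2, ∑ l : Fin 2, ∑ p : Fin 2,
    ((ρ * (onQubit (XY k) i * onQubit (XY l) j * onQubit (XY p) m)).trace.re) ^ 2

/-- The xy-plane Bell strength 𝒯²_{ijml}(ρ) of the quadruple of qubits (i,j,m,l). -/
def T2quad {n : ℕ} (ρ : Matrix (Fin n → Fin 2) (Fin n → Fin 2) ℂ) (i j m l : Fin n) : ℝ :=
  ∑ k : Fin 2, ∑ k' : Fin 2, ∑ k'' : Fin 2, ∑ k''' : Fin 2,
    ((ρ * (onQubit (XY k) i * onQubit (XY k') j * onQubit (XY k'') m *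
        onQubit (XY k''') l)).trace.re) ^ 2

/-- The xz-plane Bell strength of the pair of qubits (i,j). -/
def T2pairXZ {n : ℕ} (ρ : Matrix (Fin n → Fin 2) (Fin n → Fin 2) ℂ) (i j : Fin n) : ℝ :=
  ∑ k : Fin 2, ∑ l : Fin 2,
    ((ρ * (onQubit (XZ k) i * onQubit (XZ l) j)).trace.re) ^ 2

/-- The tensor product of the single-qubit operators `F s`. -/
def prodMat {n : ℕ} (F : Fin n → Matrix (Fin 2) (Fin 2) ℂ) :
    Matrix (Fin n → Fin 2) (Fin n → Fin 2) ℂ :=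
  Matrix.of fun a b => ∏ s, F s (a s) (b s)

lemma prodMat_mul {n : ℕ} (F G : Fin n → Matrix (Fin 2) (Fin 2) ℂ) :
    prodMat F * prodMat G = prodMat (F * G) := by
  ext a b
  simp only [prodMat, Matrix.mul_apply, Matrix.of_apply, Pi.mul_apply, ← Finset.prod_mul_distrib]
  exact (Fintype.prod_sum fun s x => F s (a s) x * G s x (b s)).symm

lemma onQubit_eq_prodMat {n : ℕ} (M : Matrix (Fin 2) (Fin 2) ℂ) (i : Fin n) :
    onQubit M i = prodMat (Pi.mulSingle i M) := by
  ext a b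
  simp only [onQubit, prodMat, Matrix.of_apply]
  refine Finset.prod_congr rfl fun s _ => ?_
  by_cases h : s = i
  · subst h; simp
  · simp [h, Matrix.one_apply]

lemma onQubit_mul_same {n : ℕ} (M N : Matrix (Fin 2) (Fin 2) ℂ) (i : Fin n) :
    onQubit M i * onQubit N i = onQubit (M * N) i := by
  simp only [onQubit_eq_prodMat, prodMat_mul, Pi.mulSingle_mul]

lemma onQubit_commute {n : ℕ} (M N : Matrix (Fin 2) (Fin 2) ℂ) {i j : Fin n} (h : i ≠ j) :
    Commute (onQubit M i) (onQubit N j) := by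
  simpa only [Commute, SemiconjBy, onQubit_eq_prodMat, prodMat_mul] using congrArg prodMat
    (Pi.mulSingle_commute (f := fun _ : Fin n => Matrix (Fin 2) (Fin 2) ℂ) h M N).eq

lemma onQubit_apply {n : ℕ} (M : Matrix (Fin 2) (Fin 2) ℂ) (i : Fin n) (a b : Fin n → Fin 2) :
    onQubit M i a b =
      M (a i) (b i) * ∏ s ∈ Finset.univ.erase i, if a s = b s then 1 else 0 := by
  rw [onQubit, Matrix.of_apply, ← Finset.mul_prod_erase _ _ (Finset.mem_univ i), if_pos rfl]
  congr 1
  exact Finset.prod_congr rfl fun s hs => if_neg (Finset.ne_of_mem_erase hs)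

lemma onQubit_one {n : ℕ} (i : Fin n) : onQubit 1 i = 1 := by
  ext a b
  simp only [onQubit, Matrix.of_apply, Matrix.one_apply, ite_self, Finset.prod_ite_zero,
    Finset.prod_const_one, Finset.mem_univ, true_implies, funext_iff]

lemma onQubit_neg {n : ℕ} (M : Matrix (Fin 2) (Fin 2) ℂ) (i : Fin n) :
    onQubit (-M) i = -onQubit M i := by
  ext a b
  simp only [onQubit_apply, Matrix.neg_apply, neg_mul]

lemma onQubit_conjTranspose {n : ℕ} (M : Matrix (Fin 2) (Fin 2) ℂ) (i : Fin n) :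
    (onQubit M i)ᴴ = onQubit Mᴴ i := by
  ext a b
  simp only [onQubit, Matrix.of_apply, Matrix.conjTranspose_apply, star_prod]
  refine Finset.prod_congr rfl fun s _ => ?_
  split_ifs <;> simp_all

lemma pY_conjTranspose : pYᴴ = pY := by
  ext i j; fin_cases i <;> fin_cases j <;> simp [pY]

lemma pY_mul_self : pY * pY = 1 := by
  ext i j; fin_cases i <;> fin_cases j <;> simp [pY]

lemma pY_conj_XZ (k : Fin 2) : pY * XZ k * pY = -XZ k := by
  ext i j; fin_cases k <;> fin_cases i <;> fin_cases j <;> simp [pY, pX, pZ, XZ]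

lemma onQubit_pY_mul_self {n : ℕ} (j : Fin n) : onQubit pY j * onQubit pY j = 1 := by
  rw [onQubit_mul_same, pY_mul_self, onQubit_one]

lemma onQubit_pY_conj_XZ {n : ℕ} (j : Fin n) (l : Fin 2) :
    onQubit pY j * onQubit (XZ l) j * onQubit pY j = -onQubit (XZ l) j := by
  rw [onQubit_mul_same, onQubit_mul_same, pY_conj_XZ, onQubit_neg]

/-- Mixing `ρ` with its conjugate by `σ_y` on qubit `m`. -/
def mixY {n : ℕ} (c : ℝ) (m : Fin n) (ρ : Matrix (Fin n → Fin 2) (Fin n → Fin 2) ℂ) :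
    Matrix (Fin n → Fin 2) (Fin n → Fin 2) ℂ :=
  (((1 + c) / 2 : ℝ) : ℂ) • ρ + (((1 - c) / 2 : ℝ) : ℂ) • (onQubit pY m * ρ * onQubit pY m)

lemma IsDensityMatrix.mixY {n : ℕ} {ρ : Matrix (Fin n → Fin 2) (Fin n → Fin 2) ℂ}
    (hρ : IsDensityMatrix ρ) {c : ℝ} (h0 : 0 ≤ c) (h1 : c ≤ 1) (m : Fin n) :
    IsDensityMatrix (mixY c m ρ) := by
  obtain ⟨hpos, htr⟩ := hρ
  constructor
  · refine (hpos.smul ?_).add (Matrix.PosSemidef.smul ?_ ?_)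
    · exact_mod_cast (by linarith : (0 : ℝ) ≤ (1 + c) / 2)
    · have := hpos.mul_mul_conjTranspose_same (onQubit pY m)
      rwa [onQubit_conjTranspose, pY_conjTranspose] at this
    · exact_mod_cast (by linarith : (0 : ℝ) ≤ (1 - c) / 2)
  · rw [_root_.mixY, Matrix.trace_add, Matrix.trace_smul, Matrix.trace_smul, Matrix.trace_mul_cycle,
      onQubit_pY_mul_self, one_mul, htr]
    push_cast
    simp only [smul_eq_mul]
    ring

lemma trace_mixY_mul {n : ℕ} (c : ℝ) (m : Fin n) (ρ A : Matrix (Fin n → Fin 2) (Fin n → Fin 2) ℂ) :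
    (mixY c m ρ * A).trace = (((1 + c) / 2 : ℝ) : ℂ) * (ρ * A).trace +
      (((1 - c) / 2 : ℝ) : ℂ) * (ρ * (onQubit pY m * A * onQubit pY m)).trace := by
  rw [mixY, add_mul, Matrix.trace_add, Matrix.smul_mul, Matrix.smul_mul, Matrix.trace_smul,
    Matrix.trace_smul, smul_eq_mul, smul_eq_mul]
  congr 2
  rw [Matrix.mul_assoc, Matrix.mul_assoc, Matrix.trace_mul_comm]
  simp only [Matrix.mul_assoc]

lemma T2pairXZ_mixY_right {n : ℕ} (c : ℝ) (ρ : Matrix (Fin n → Fin 2) (Fin n → Fin 2) ℂ)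
    {i j : Fin n} (h : i ≠ j) : T2pairXZ (mixY c j ρ) i j = c ^ 2 * T2pairXZ ρ i j := by
  simp only [T2pairXZ, Finset.mul_sum]
  refine Finset.sum_congr rfl fun k _ => Finset.sum_congr rfl fun l _ => ?_
  have hconj : onQubit pY j * (onQubit (XZ k) i * onQubit (XZ l) j) * onQubit pY j =
      -(onQubit (XZ k) i * onQubit (XZ l) j) := by
    rw [← mul_assoc, (onQubit_commute pY (XZ k) h.symm).eq, mul_assoc, mul_assoc,
      ← mul_assoc (onQubit pY j), onQubit_pY_conj_XZ, mul_neg]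
  rw [trace_mixY_mul, hconj, mul_neg, Matrix.trace_neg, Complex.add_re, Complex.re_ofReal_mul,
    Complex.re_ofReal_mul, Complex.neg_re]
  ring

lemma T2pairXZ_mixY_of_ne {n : ℕ} (c : ℝ) (ρ : Matrix (Fin n → Fin 2) (Fin n → Fin 2) ℂ)
    {i j m : Fin n} (hi : m ≠ i) (hj : m ≠ j) : T2pairXZ (mixY c m ρ) i j = T2pairXZ ρ i j := by
  simp only [T2pairXZ]
  refine Finset.sum_congr rfl fun k _ => Finset.sum_congr rfl fun l _ => ?_
  have hconj : onQubit pY m * (onQubit (XZ k) i * onQubit (XZ l) j) * onQubit pY m =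
      onQubit (XZ k) i * onQubit (XZ l) j := by
    rw [((onQubit_commute pY (XZ k) hi).mul_right (onQubit_commute pY (XZ l) hj)).eq, mul_assoc,
      onQubit_pY_mul_self, mul_one]
  rw [trace_mixY_mul, hconj, Complex.add_re, Complex.re_ofReal_mul, Complex.re_ofReal_mul]
  ring

lemma onQubit_mulVec {n : ℕ} (M : Matrix (Fin 2) (Fin 2) ℂ) (i : Fin n)
    (ψ : (Fin n → Fin 2) → ℂ) (a : Fin n → Fin 2) :
    (onQubit M i *ᵥ ψ) a = ∑ x, M (a i) x * ψ (Function.update a i x) := by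
  rw [Matrix.mulVec, dotProduct]
  refine (Fintype.sum_of_injective _ (Function.update_injective a i) _ _ (fun b hb => ?_)
    fun x => ?_).symm
  · obtain ⟨s, hs, hne⟩ : ∃ s, s ≠ i ∧ a s ≠ b s := by
      by_contra! hall
      refine hb ⟨b i, funext fun s => ?_⟩
      by_cases hs : s = i
      · subst hs; simp
      · simp [hs, hall s hs]
    rw [onQubit_apply, Finset.prod_eq_zero (Finset.mem_erase.2 ⟨hs, Finset.mem_univ s⟩)
      (if_neg hne), mul_zero, zero_mul]
  · rw [onQubit_apply, Finset.prod_eq_one fun s hs => ?_]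
    · simp
    · simp [Finset.ne_of_mem_erase hs]

/-- The projector onto a real state vector. -/
def pureState {n : ℕ} (ψ : (Fin n → Fin 2) → ℝ) : Matrix (Fin n → Fin 2) (Fin n → Fin 2) ℂ :=
  Matrix.vecMulVec (fun a => (ψ a : ℂ)) (fun a => (ψ a : ℂ))

lemma isDensityMatrix_pureState {n : ℕ} {ψ : (Fin n → Fin 2) → ℝ} (h : ∑ a, ψ a ^ 2 = 1) :
    IsDensityMatrix (pureState ψ) := by
  constructor
  · have := Matrix.posSemidef_vecMulVec_self_star (fun a => (ψ a : ℂ))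
    convert this using 1
    ext a b
    simp [pureState, Matrix.vecMulVec_apply]
  · simp only [Matrix.trace, Matrix.diag_apply, pureState, Matrix.vecMulVec_apply]
    rw [← Complex.ofReal_one, ← h]
    push_cast
    exact Finset.sum_congr rfl fun a _ => (sq _).symm

lemma sum_XZ_mul (k x : Fin 2) (f : Fin 2 → ℂ) :
    ∑ y, XZ k x y * f y = if k = 0 then f (1 - x) else (-1) ^ (x : ℕ) * f x := by
  fin_cases k <;> fin_cases x <;> simp [XZ, pX, pZ]

lemma trace_pureState_mul {n : ℕ} (ψ : (Fin n → Fin 2) → ℝ)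
    (A B : Matrix (Fin n → Fin 2) (Fin n → Fin 2) ℂ) :
    (pureState ψ * (A * B)).trace = ∑ a, (ψ a : ℂ) * (A *ᵥ (B *ᵥ fun a => (ψ a : ℂ))) a := by
  rw [pureState, Matrix.vecMulVec_mul, Matrix.trace_vecMulVec, Matrix.mulVec_mulVec,
    dotProduct_comm, ← Matrix.dotProduct_mulVec]
  rfl

lemma sum_fin_four_fun {M : Type*} [AddCommMonoid M] (f : (Fin 4 → Fin 2) → M) :
    ∑ a, f a = ∑ x, ∑ y, ∑ z, ∑ w, f ![x, y, z, w] := by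
  have key : ∀ {n : ℕ} (g : (Fin (n + 1) → Fin 2) → M),
      ∑ a, g a = ∑ x, ∑ b : Fin n → Fin 2, g (Matrix.vecCons x b) := fun g => by
    rw [← Fintype.sum_prod_type']
    exact (Fintype.sum_equiv (Fin.consEquiv fun _ => Fin 2) _ _ fun _ => rfl).symm
  simp only [key, Fintype.sum_unique]
  rfl

/-- The state `p (|0000⟩ + |1111⟩) + q (|0011⟩ + |1100⟩)`. -/
def chainState (p q : ℝ) (a : Fin 4 → Fin 2) : ℝ :=
  if a 0 = a 1 ∧ a 2 = a 3 then (if a 0 = a 2 then p else q) else 0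

/-- The state `p (|0000⟩ + |1111⟩) + q (|0101⟩ + |1010⟩)`. -/
def crossState (p q : ℝ) (a : Fin 4 → Fin 2) : ℝ :=
  if a 0 = a 2 ∧ a 1 = a 3 then (if a 0 = a 1 then p else q) else 0

lemma sum_chainState_sq (p q : ℝ) : ∑ a, chainState p q a ^ 2 = 2 * p ^ 2 + 2 * q ^ 2 := by
  rw [sum_fin_four_fun]
  simp [Fin.sum_univ_two, chainState]
  ring

lemma T2pairXZ_chainState_0_1 (p q : ℝ) : T2pairXZ (pureState (chainState p q)) 0 1 =
    (4 * p * q) ^ 2 + (2 * p ^ 2 + 2 * q ^ 2) ^ 2 := by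
  simp only [T2pairXZ, trace_pureState_mul, onQubit_mulVec, sum_XZ_mul, sum_fin_four_fun]
  simp [Fin.sum_univ_two, chainState, Function.update]
  ring

lemma T2pairXZ_chainState_0_2 (p q : ℝ) : T2pairXZ (pureState (chainState p q)) 0 2 =
    (2 * p ^ 2 - 2 * q ^ 2) ^ 2 := by
  simp only [T2pairXZ, trace_pureState_mul, onQubit_mulVec, sum_XZ_mul, sum_fin_four_fun]
  simp [Fin.sum_univ_two, chainState, Function.update]
  ring

lemma T2pairXZ_chainState_2_3 (p q : ℝ) : T2pairXZ (pureState (chainState p q)) 2 3 =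
    (4 * p * q) ^ 2 + (2 * p ^ 2 + 2 * q ^ 2) ^ 2 := by
  simp only [T2pairXZ, trace_pureState_mul, onQubit_mulVec, sum_XZ_mul, sum_fin_four_fun]
  simp [Fin.sum_univ_two, chainState, Function.update]
  ring

lemma sum_crossState_sq (p q : ℝ) : ∑ a, crossState p q a ^ 2 = 2 * p ^ 2 + 2 * q ^ 2 := by
  rw [sum_fin_four_fun]
  simp [Fin.sum_univ_two, crossState]
  ring

lemma T2pairXZ_crossState_0_1 (p q : ℝ) : T2pairXZ (pureState (crossState p q)) 0 1 =
    (2 * p ^ 2 - 2 * q ^ 2) ^ 2 := by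
  simp only [T2pairXZ, trace_pureState_mul, onQubit_mulVec, sum_XZ_mul, sum_fin_four_fun]
  simp [Fin.sum_univ_two, crossState, Function.update]
  ring

lemma T2pairXZ_crossState_0_2 (p q : ℝ) : T2pairXZ (pureState (crossState p q)) 0 2 =
    (4 * p * q) ^ 2 + (2 * p ^ 2 + 2 * q ^ 2) ^ 2 := by
  simp only [T2pairXZ, trace_pureState_mul, onQubit_mulVec, sum_XZ_mul, sum_fin_four_fun]
  simp [Fin.sum_univ_two, crossState, Function.update]
  ring

lemma T2pairXZ_crossState_2_3 (p q : ℝ) : T2pairXZ (pureState (crossState p q)) 2 3 =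
    (2 * p ^ 2 - 2 * q ^ 2) ^ 2 := by
  simp only [T2pairXZ, trace_pureState_mul, onQubit_mulVec, sum_XZ_mul, sum_fin_four_fun]
  simp [Fin.sum_univ_two, crossState, Function.update]
  ring

lemma exists_amplitudes {s : ℝ} (h0 : 0 ≤ s) (h1 : s ≤ 1) :
    ∃ p q : ℝ, 2 * p ^ 2 + 2 * q ^ 2 = 1 ∧ 2 * p ^ 2 - 2 * q ^ 2 = s ∧
      (4 * p * q) ^ 2 = 1 - s ^ 2 := by
  have hp := Real.sq_sqrt (show 0 ≤ (1 + s) / 4 by linarith)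
  have hq := Real.sq_sqrt (show 0 ≤ (1 - s) / 4 by linarith)
  refine ⟨√((1 + s) / 4), √((1 - s) / 4), ?_, ?_, ?_⟩
  · rw [hp, hq]; ring
  · rw [hp, hq]; ring
  · rw [mul_pow, mul_pow, hp, hq]; ring

/-- The boundary of the Steinmetz solid is realized by pure states. -/
lemma exists_boundary_state {t : ℝ} (h0 : 0 ≤ t) (ht : t ≤ 2) :
    ∃ ρ : Matrix (Fin 4 → Fin 2) (Fin 4 → Fin 2) ℂ, IsDensityMatrix ρ ∧
      T2pairXZ ρ 0 1 = 2 - t ∧ T2pairXZ ρ 0 2 = t ∧ T2pairXZ ρ 2 3 = 2 - t := by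
  rcases le_total t 1 with h | h
  · obtain ⟨p, q, hn, hd, hm⟩ := exists_amplitudes (Real.sqrt_nonneg t) (Real.sqrt_le_one.2 h)
    rw [Real.sq_sqrt h0] at hm
    refine ⟨_, isDensityMatrix_pureState ((sum_chainState_sq p q).trans hn), ?_, ?_, ?_⟩
    · rw [T2pairXZ_chainState_0_1, hm, hn]; ring
    · rw [T2pairXZ_chainState_0_2, hd, Real.sq_sqrt h0]
    · rw [T2pairXZ_chainState_2_3, hm, hn]; ring
  · have h2 : 0 ≤ 2 - t := by linarith
    obtain ⟨p, q, hn, hd, hm⟩ := exists_amplitudes (Real.sqrt_nonneg (2 - t))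
      (Real.sqrt_le_one.2 (by linarith))
    rw [Real.sq_sqrt h2] at hm
    refine ⟨_, isDensityMatrix_pureState ((sum_crossState_sq p q).trans hn), ?_, ?_, ?_⟩
    · rw [T2pairXZ_crossState_0_1, hd, Real.sq_sqrt h2]
    · rw [T2pairXZ_crossState_0_2, hm, hn]; ring
    · rw [T2pairXZ_crossState_2_3, hd, Real.sq_sqrt h2]

lemma exists_sq_mul_eq {u v : ℝ} (hu : 0 ≤ u) (huv : u ≤ v) :
    ∃ c : ℝ, 0 ≤ c ∧ c ≤ 1 ∧ c ^ 2 * v = u := by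
  have hv : 0 ≤ v := hu.trans huv
  refine ⟨√(u / v), Real.sqrt_nonneg _, Real.sqrt_le_one.2 (div_le_one_of_le₀ huv hv), ?_⟩
  rw [Real.sq_sqrt (div_nonneg hu hv)]
  exact div_mul_cancel_of_imp fun h => le_antisymm (h ▸ huv) hu

/-- **Quantum realizability of the Steinmetz solid in the chain configuration.** For four
qubits in a chain with links (1,2), (1,3), (3,4) (here 0-indexed: (0,1), (0,2), (2,3)) and
nonnegative values b₁₂, b₁₃, b₃₄ satisfying b₁₂² + b₁₃² ≤ 2 and b₁₃² + b₃₄² ≤ 2, there is a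
4-qubit density matrix realizing exactly these squared xz-plane Bell strengths. -/
theorem steinmetz_chain_realizable (b12 b13 b34 : ℝ)
    (h12 : 0 ≤ b12) (h13 : 0 ≤ b13) (h34 : 0 ≤ b34)
    (hmono1 : b12 ^ 2 + b13 ^ 2 ≤ 2) (hmono2 : b13 ^ 2 + b34 ^ 2 ≤ 2) :
    ∃ ρ : Matrix (Fin 4 → Fin 2) (Fin 4 → Fin 2) ℂ,
      IsDensityMatrix ρ ∧
      T2pairXZ ρ 0 1 = b12 ^ 2 ∧ T2pairXZ ρ 0 2 = b13 ^ 2 ∧ T2pairXZ ρ 2 3 = b34 ^ 2 := by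
  obtain ⟨ρ, hρ, h01, h02, h23⟩ :=
    exists_boundary_state (sq_nonneg b13) (by nlinarith [sq_nonneg b12])
  obtain ⟨c, hc0, hc1, hc⟩ :=
    exists_sq_mul_eq (sq_nonneg b12) (by linarith : b12 ^ 2 ≤ 2 - b13 ^ 2)
  obtain ⟨d, hd0, hd1, hd⟩ :=
    exists_sq_mul_eq (sq_nonneg b34) (by linarith : b34 ^ 2 ≤ 2 - b13 ^ 2)
  refine ⟨mixY d 3 (mixY c 1 ρ), (hρ.mixY hc0 hc1 1).mixY hd0 hd1 3, ?_, ?_, ?_⟩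
  · rw [T2pairXZ_mixY_of_ne _ _ (by decide) (by decide), T2pairXZ_mixY_right _ _ (by decide),
      h01, hc]
  · rw [T2pairXZ_mixY_of_ne _ _ (by decide) (by decide),
      T2pairXZ_mixY_of_ne _ _ (by decide) (by decide), h02]
  · rw [T2pairXZ_mixY_right _ _ (by decide), T2pairXZ_mixY_of_ne _ _ (by decide) (by decide),
      h23, hd]
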